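/- With Σ denoting closed Schubert sets in SU_n: (1) if 1 < m_1 < m_2 ≤ n, then the set products satisfy Σ_{m_2}·Σ_{m_1} = Σ_{m_1}·Σ_{m_2} = Σ_{(m_1,m_2)}; and (2) if 1 < m' ≤ n, then Σ_{m'}·Σ_{m'} ⊆ Σ_{(m'−1, m')}. -/

import Mathlib

open Matrix Complex Pointwise

/-- The pseudo-rotation `A_{(θ,x)} = Iₙ − (1 − e^{iθ})·x·x̄ᵀ`. -/
noncomputable def pseudoRot {n : ℕ} (θ : ℝ) (x : Fin n → ℂ) : Matrix (Fin n) (Fin n) ℂ :=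
  1 - (1 - Complex.exp (θ * Complex.I)) • Matrix.vecMulVec x (star x)

/-- The first standard basis vector `e₁` of `ℂⁿ`. -/
noncomputable def e1 (n : ℕ) : Fin n → ℂ := fun i => if (i : ℕ) = 0 then 1 else 0

/-- The closed Schubert set `Σ_𝐦 ⊆ SU_n`: all products
`A_{(−(θ₁+⋯+θ_r), e₁)}·A_{(θ₁,x₁)}⋯A_{(θ_r,x_r)}` where each `x_j` is a unit vector
lying in `ℂ^{m_j}` (its 0-based coordinates `≥ m_j` vanish). -/
noncomputable def schubertSet (n : ℕ) {r : ℕ} (m : Fin r → ℕ) :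
    Set (Matrix (Fin n) (Fin n) ℂ) :=
  { M | ∃ (θ : Fin r → ℝ) (x : Fin r → Fin n → ℂ),
      (∀ j, star (x j) ⬝ᵥ x j = 1 ∧ ∀ i : Fin n, m j ≤ (i : ℕ) → x j i = 0) ∧
      M = pseudoRot (-(∑ j, θ j)) (e1 n) *
        (List.ofFn fun j => pseudoRot (θ j) (x j)).prod }

/-- unit vector supported in the first `m` coordinates -/
def UV {n : ℕ} (m : ℕ) (x : Fin n → ℂ) : Prop :=
  star x ⬝ᵥ x = 1 ∧ ∀ i : Fin n, m ≤ (i : ℕ) → x i = 0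

theorem UV.mono {n a b : ℕ} {x : Fin n → ℂ} (h : UV a x) (hab : a ≤ b) : UV b x :=
  ⟨h.1, fun i hi => h.2 i (hab.trans hi)⟩

theorem P_mulVec {n : ℕ} (θ : ℝ) (x z : Fin n → ℂ) :
    pseudoRot θ x *ᵥ z = z - ((1 - Complex.exp (θ * Complex.I)) * (star x ⬝ᵥ z)) • x := by
  unfold pseudoRot
  rw [Matrix.sub_mulVec, Matrix.one_mulVec, Matrix.smul_mulVec, Matrix.vecMulVec_mulVec]
  ext i
  simp
  ring

theorem P_zero {n : ℕ} (x : Fin n → ℂ) : pseudoRot 0 x = 1 := by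
  simp [pseudoRot]

theorem P_mul_same {n : ℕ} (θ φ : ℝ) (x : Fin n → ℂ) (hx : star x ⬝ᵥ x = 1) :
    pseudoRot θ x * pseudoRot φ x = pseudoRot (θ + φ) x := by
  unfold pseudoRot
  have h : Matrix.vecMulVec x (star x) * Matrix.vecMulVec x (star x)
      = Matrix.vecMulVec x (star x) := by
    rw [Matrix.vecMulVec_mul_vecMulVec, hx, one_smul]
  have e : Complex.exp (((θ + φ : ℝ) : ℂ) * Complex.I)
      = Complex.exp (θ * Complex.I) * Complex.exp (φ * Complex.I) := by
    rw [← Complex.exp_add]; push_cast; ring_nf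
  rw [e]
  simp only [sub_mul, mul_sub, one_mul, mul_one, smul_mul_assoc, mul_smul_comm, h, smul_smul]
  module

theorem P_star {n : ℕ} (θ : ℝ) (x : Fin n → ℂ) : (pseudoRot θ x)ᴴ = pseudoRot (-θ) x := by
  unfold pseudoRot
  rw [Matrix.conjTranspose_sub, Matrix.conjTranspose_smul, Matrix.conjTranspose_one,
    Matrix.conjTranspose_vecMulVec, star_star]
  congr 2
  simp [← Complex.exp_conj]

theorem P_unit {n : ℕ} (θ : ℝ) (x : Fin n → ℂ) (hx : star x ⬝ᵥ x = 1) :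
    (pseudoRot θ x)ᴴ * pseudoRot θ x = 1 := by
  rw [P_star, P_mul_same _ _ _ hx]; simp [P_zero]

theorem P_det {n : ℕ} (θ : ℝ) (x : Fin n → ℂ) (hx : star x ⬝ᵥ x = 1) :
    (pseudoRot θ x).det = Complex.exp (θ * Complex.I) := by
  have : pseudoRot θ x = 1 + Matrix.replicateCol Unit ((-(1 - Complex.exp (θ * Complex.I))) • x) *
      Matrix.replicateRow Unit (star x) := by
    rw [← Matrix.vecMulVec_eq, Matrix.smul_vecMulVec, pseudoRot]
    module
  rw [this, Matrix.det_one_add_replicateCol_mul_replicateRow, dotProduct_smul, hx]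
  simp

theorem dot_unit {n : ℕ} {U : Matrix (Fin n) (Fin n) ℂ} (hU : Uᴴ * U = 1) (x y : Fin n → ℂ) :
    star (U *ᵥ x) ⬝ᵥ (U *ᵥ y) = star x ⬝ᵥ y := by
  rw [Matrix.star_mulVec, ← Matrix.dotProduct_mulVec, Matrix.mulVec_mulVec, hU, Matrix.one_mulVec]

theorem P_conj {n : ℕ} (θ : ℝ) (x : Fin n → ℂ) {U : Matrix (Fin n) (Fin n) ℂ}
    (hU : Uᴴ * U = 1) : U * pseudoRot θ x = pseudoRot θ (U *ᵥ x) * U := by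
  unfold pseudoRot
  rw [mul_sub, sub_mul, Matrix.mul_smul, Matrix.smul_mul, Matrix.star_mulVec,
    Matrix.mul_vecMulVec, Matrix.vecMulVec_mul, Matrix.vecMul_vecMul, hU]
  simp

theorem UV_P {n a b : ℕ} {x y : Fin n → ℂ} (θ : ℝ) (hy : UV a y) (hx : UV b x) (hab : a ≤ b) :
    UV b (pseudoRot θ y *ᵥ x) := by
  refine ⟨?_, ?_⟩
  · rw [dot_unit (P_unit _ _ hy.1), hx.1]
  · intro i hi
    rw [P_mulVec]
    simp [hx.2 i hi, hy.2 i (hab.trans hi)]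

theorem UV_e1 {n : ℕ} (hn : 1 ≤ n) {m : ℕ} (hm : 1 ≤ m) : UV m (e1 n) := by
  refine ⟨?_, ?_⟩
  · simp only [dotProduct]
    rw [Finset.sum_eq_single (⟨0, hn⟩ : Fin n)]
    · simp [e1]
    · intro b _ hb
      have : (b : ℕ) ≠ 0 := fun h => hb (Fin.ext h)
      simp [e1, this]
    · simp
  · intro i hi
    have : (i : ℕ) ≠ 0 := by omega
    simp [e1, this]

theorem mem_one {n m : ℕ} (M : Matrix (Fin n) (Fin n) ℂ) : M ∈ schubertSet n ![m] ↔
    ∃ (θ : ℝ) (x : Fin n → ℂ), UV m x ∧ M = pseudoRot (-θ) (e1 n) * pseudoRot θ x := by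
  constructor
  · rintro ⟨θ, x, h, rfl⟩
    exact ⟨θ 0, x 0, h 0, by simp⟩
  · rintro ⟨θ, x, h, rfl⟩
    refine ⟨![θ], ![x], ?_, by simp⟩
    intro j
    fin_cases j
    exact h

theorem mem_two {n a b : ℕ} (M : Matrix (Fin n) (Fin n) ℂ) : M ∈ schubertSet n ![a, b] ↔
    ∃ (θ φ : ℝ) (x y : Fin n → ℂ), UV a x ∧ UV b y ∧
      M = pseudoRot (-(θ + φ)) (e1 n) * (pseudoRot θ x * pseudoRot φ y) := by
  constructor
  · rintro ⟨θ, x, h, rfl⟩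
    exact ⟨θ 0, θ 1, x 0, x 1, h 0, h 1, by simp [Fin.sum_univ_two]⟩
  · rintro ⟨θ, φ, x, y, hx, hy, rfl⟩
    refine ⟨![θ, φ], ![x, y], ?_, by simp [Fin.sum_univ_two]⟩
    intro j
    fin_cases j
    · exact hx
    · exact hy

theorem P_move {n : ℕ} (θ φ : ℝ) (x y : Fin n → ℂ) (hx : star x ⬝ᵥ x = 1) :
    pseudoRot φ y * pseudoRot θ x = pseudoRot θ x * pseudoRot φ (pseudoRot (-θ) x *ᵥ y) := by
  have h := P_conj φ (pseudoRot (-θ) x *ᵥ y) (P_unit θ x hx)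
  rw [h, Matrix.mulVec_mulVec, P_mul_same _ _ _ hx]
  simp [P_zero]

theorem mul_eq {n a b : ℕ} (hn : 1 ≤ n) (ha : 1 ≤ a) :
    schubertSet n ![a] * schubertSet n ![b] = schubertSet n ![a, b] := by
  have he := UV_e1 hn (le_refl 1)
  ext M
  rw [Set.mem_mul, mem_two]
  constructor
  · rintro ⟨A, hA, B, hB, rfl⟩
    obtain ⟨θ, x, hx, rfl⟩ := (mem_one A).1 hA
    obtain ⟨φ, y, hy, rfl⟩ := (mem_one B).1 hB
    refine ⟨θ, φ, pseudoRot (- -φ) (e1 n) *ᵥ x, y, UV_P _ he hx ha, hy, ?_⟩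
    have h1 := P_move (-φ) θ (e1 n) x he.1
    have h2 := P_mul_same (-θ) (-φ) (e1 n) he.1
    rw [show -(θ + φ) = -θ + -φ by ring, ← h2]
    simp only [mul_assoc]
    congr 1
    rw [← mul_assoc, h1, mul_assoc]
  · rintro ⟨θ, φ, x, y, hx, hy, rfl⟩
    refine ⟨_, (mem_one _).2 ⟨θ, pseudoRot (-φ) (e1 n) *ᵥ x, UV_P _ he hx ha, rfl⟩,
      _, (mem_one _).2 ⟨φ, y, hy, rfl⟩, ?_⟩
    have h1 := P_conj θ x (P_unit (-φ) (e1 n) he.1)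
    have h2 := P_mul_same (-θ) (-φ) (e1 n) he.1
    rw [show -(θ + φ) = -θ + -φ by ring, ← h2]
    simp only [mul_assoc]
    congr 1
    rw [← mul_assoc, ← h1, mul_assoc]

theorem swap_eq {n a b : ℕ} (hab : a ≤ b) :
    schubertSet n ![b, a] = schubertSet n ![a, b] := by
  ext M
  rw [mem_two, mem_two]
  constructor
  · rintro ⟨θ, φ, x, y, hx, hy, rfl⟩
    exact ⟨φ, θ, y, _, hy, UV_P (-φ) hy hx hab, by rw [P_move _ _ _ _ hy.1, add_comm]⟩
  · rintro ⟨θ, φ, x, y, hx, hy, rfl⟩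
    exact ⟨φ, θ, _, x, UV_P θ hx hy hab, hx,
      by rw [P_conj _ _ (P_unit _ _ hx.1), add_comm]⟩

open scoped ComplexOrder in
theorem dot_self_zero {n : ℕ} {z : Fin n → ℂ} (h : star z ⬝ᵥ z = 0) : z = 0 :=
  dotProduct_star_self_eq_zero.1 h

theorem dot_star {n : ℕ} (x y : Fin n → ℂ) : star (star x ⬝ᵥ y) = star y ⬝ᵥ x := by
  rw [Matrix.star_dotProduct, star_star]

theorem exists_unit {n : ℕ} {z : Fin n → ℂ} (h : z ≠ 0) :
    ∃ c : ℂ, c ≠ 0 ∧ star (c • z) ⬝ᵥ (c • z) = 1 := by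
  have hr : star z ⬝ᵥ z = ((∑ i, ‖z i‖ ^ 2 : ℝ) : ℂ) := by
    simp [dotProduct, Complex.conj_mul']
  set r : ℝ := ∑ i, ‖z i‖ ^ 2
  have hr0 : 0 ≤ r := Finset.sum_nonneg fun i _ => by positivity
  have hr1 : r ≠ 0 := fun h0 => h (dot_self_zero (by rw [hr, h0]; simp))
  have hs : Real.sqrt r ≠ 0 := by
    rw [Real.sqrt_ne_zero hr0]; exact hr1
  refine ⟨((Real.sqrt r)⁻¹ : ℝ), by exact_mod_cast inv_ne_zero hs, ?_⟩
  rw [star_smul, smul_dotProduct, dotProduct_smul, hr]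
  simp only [smul_eq_mul, RCLike.star_def, Complex.conj_ofReal]
  norm_cast
  field_simp
  rw [Real.sq_sqrt hr0]

theorem rank_one {n : ℕ} {U : Matrix (Fin n) (Fin n) ℂ} (hU : Uᴴ * U = 1) {y : Fin n → ℂ}
    (hy : star y ⬝ᵥ y = 1) (hfix : ∀ z, star y ⬝ᵥ z = 0 → U *ᵥ z = z) {φ : ℝ}
    (hdet : U.det = Complex.exp (φ * Complex.I)) : U = pseudoRot φ y := by
  have hUy : U *ᵥ y = (star y ⬝ᵥ (U *ᵥ y)) • y := by
    set l := star y ⬝ᵥ (U *ᵥ y) with hl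
    have h1 : star y ⬝ᵥ (U *ᵥ y - l • y) = 0 := by
      rw [dotProduct_sub, dotProduct_smul, hy, ← hl]; simp
    have h2 : star (U *ᵥ y) ⬝ᵥ (U *ᵥ y - l • y) = 0 := by
      conv_lhs => rw [← hfix _ h1]
      rw [dot_unit hU, h1]
    have h3 : star (U *ᵥ y - l • y) ⬝ᵥ (U *ᵥ y - l • y) = 0 := by
      rw [star_sub, sub_dotProduct, h2, star_smul, smul_dotProduct, h1]; simp
    exact sub_eq_zero.1 (dot_self_zero h3)
  set l := star y ⬝ᵥ (U *ᵥ y) with hl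
  have hform : U = 1 - (1 - l) • Matrix.vecMulVec y (star y) := by
    apply Matrix.ext_of_mulVec_single
    intro i
    set z : Fin n → ℂ := Pi.single i 1
    have h1 : star y ⬝ᵥ (z - (star y ⬝ᵥ z) • y) = 0 := by
      rw [dotProduct_sub, dotProduct_smul, hy]; simp
    have h2 := hfix _ h1
    rw [Matrix.mulVec_sub, Matrix.mulVec_smul, hUy] at h2
    rw [Matrix.sub_mulVec, Matrix.one_mulVec, Matrix.smul_mulVec, Matrix.vecMulVec_mulVec,
      sub_eq_iff_eq_add.1 h2]
    ext j
    simp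
    ring
  have hdl : U.det = l := by
    have : U = 1 + Matrix.replicateCol Unit ((-(1 - l)) • y) *
        Matrix.replicateRow Unit (star y) := by
      rw [← Matrix.vecMulVec_eq, Matrix.smul_vecMulVec]
      conv_lhs => rw [hform]
      module
    rw [this, Matrix.det_one_add_replicateCol_mul_replicateRow, dotProduct_smul, hy]
    simp
  rw [pseudoRot, ← hdet, hdl]
  exact hform

theorem exists_rot {n : ℕ} {x z w : Fin n → ℂ} (hx : star x ⬝ᵥ x = 1) {c : ℂ}
    (h : w = z + c • x) (hn : star w ⬝ᵥ w = star z ⬝ᵥ z) :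
    ∃ θ : ℝ, pseudoRot θ x *ᵥ z = w := by
  set a := star x ⬝ᵥ z with ha
  have ha' : star z ⬝ᵥ x = star a := by rw [ha, dot_star]
  have hab : (a + c) * star (a + c) = a * star a := by
    subst h
    simp only [star_add, star_smul, add_dotProduct, dotProduct_add, smul_dotProduct,
      dotProduct_smul, smul_eq_mul, hx, ha', ← ha] at hn ⊢
    linear_combination hn
  have hnorm : ‖a + c‖ = ‖a‖ := by
    have h1 := congrArg norm hab
    rw [norm_mul, norm_mul, norm_star, norm_star] at h1
    nlinarith [norm_nonneg (a + c), norm_nonneg a]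
  by_cases ha0 : a = 0
  · refine ⟨0, ?_⟩
    have hc : c = 0 := by simpa [ha0] using hnorm
    simp [P_zero, h, hc]
  · have h1 : ‖(a + c) / a‖ = 1 := by
      rw [norm_div, hnorm, div_self (norm_ne_zero_iff.2 ha0)]
    refine ⟨Complex.arg ((a + c) / a), ?_⟩
    have h2 := Complex.norm_mul_exp_arg_mul_I ((a + c) / a)
    rw [h1] at h2
    simp only [Complex.ofReal_one, one_mul] at h2
    rw [P_mulVec, h2, ← ha, h]
    have : (1 - (a + c) / a) * a = -c := by field_simp; ring
    rw [this]
    module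

theorem key {n : ℕ} {m : ℕ} (hm : 1 < m) (hmn : m ≤ n) (θ φ : ℝ) {x y : Fin n → ℂ}
    (hx : UV m x) (hy : UV m y) : ∃ (θ' φ' : ℝ) (x' y' : Fin n → ℂ), UV (m - 1) x' ∧ UV m y' ∧
      θ' + φ' = θ + φ ∧ pseudoRot θ x * pseudoRot φ y = pseudoRot θ' x' * pseudoRot φ' y' := by
  set i0 : Fin n := ⟨m - 1, by omega⟩ with hi0
  have hlast : ∀ z : Fin n → ℂ, (∀ i : Fin n, m ≤ (i : ℕ) → z i = 0) → z i0 = 0 →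
      ∀ i : Fin n, m - 1 ≤ (i : ℕ) → z i = 0 := by
    intro z hz h0 i hi
    by_cases h : m ≤ (i : ℕ)
    · exact hz i h
    · have : i = i0 := Fin.ext (by simp [hi0]; omega)
      rw [this, h0]
  have hee : UV (m - 1) (e1 n) := UV_e1 (by omega) (by omega)
  -- trivial cases
  by_cases hx0 : x i0 = 0
  · exact ⟨θ, φ, x, y, ⟨hx.1, hlast x hx.2 hx0⟩, hy, rfl, rfl⟩
  by_cases hy0 : y i0 = 0
  · exact ⟨φ, θ, y, _, ⟨hy.1, hlast y hy.2 hy0⟩, UV_P (-φ) hy hx le_rfl, add_comm _ _,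
      P_move _ _ _ _ hy.1⟩
  set a : ℂ := 1 - Complex.exp (θ * Complex.I) with ha
  set b : ℂ := 1 - Complex.exp (φ * Complex.I) with hb
  by_cases ha0 : a = 0
  · have hA : pseudoRot θ x = 1 := by rw [pseudoRot, ← ha, ha0]; simp
    have hA' : pseudoRot θ (e1 n) = 1 := by rw [pseudoRot, ← ha, ha0]; simp
    exact ⟨θ, φ, e1 n, y, hee, hy, rfl, by rw [hA, hA']⟩
  by_cases hb0 : b = 0
  · have hA : pseudoRot φ y = 1 := by rw [pseudoRot, ← hb, hb0]; simp
    have hA' : pseudoRot φ (e1 n) = 1 := by rw [pseudoRot, ← hb, hb0]; simp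
    exact ⟨φ, θ, e1 n, x, hee, hx, add_comm _ _, by rw [hA, hA', one_mul, mul_one]⟩
  set g : ℂ := star x ⬝ᵥ y with hg
  have hg' : star y ⬝ᵥ x = star g := by rw [hg, dot_star]
  -- dependent case
  by_cases hd : 1 - g * star g = 0
  · have hxy : y = g • x := by
      apply sub_eq_zero.1
      apply dot_self_zero
      simp only [star_sub, star_smul, sub_dotProduct, dotProduct_sub, smul_dotProduct,
        dotProduct_smul, smul_eq_mul, hx.1, hy.1, hg', ← hg]
      linear_combination hd
    have hP : pseudoRot φ y = pseudoRot φ x := by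
      unfold pseudoRot
      rw [hxy, star_smul, Matrix.smul_vecMulVec, Matrix.vecMulVec_smul, smul_smul g,
        ← sub_eq_zero.1 hd, one_smul]
    exact ⟨0, θ + φ, e1 n, x, hee, hx, by ring,
      by rw [hP, P_mul_same _ _ _ hx.1, P_zero, one_mul]⟩
  -- independence
  have hind : ∀ s t : ℂ, s • x + t • y = 0 → s = 0 ∧ t = 0 := by
    intro s t h
    have h1 : star x ⬝ᵥ (s • x + t • y) = 0 := by rw [h]; simp
    have h2 : star y ⬝ᵥ (s • x + t • y) = 0 := by rw [h]; simp
    simp only [dotProduct_add, dotProduct_smul, smul_eq_mul, hx.1, hy.1, hg', ← hg] at h1 h2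
    have ht : (1 - g * star g) * t = 0 := by linear_combination h2 - star g * h1
    have hs : (1 - g * star g) * s = 0 := by linear_combination h1 - g * h2
    exact ⟨(mul_eq_zero.1 hs).resolve_left hd, (mul_eq_zero.1 ht).resolve_left hd⟩
  -- the vector v
  set q : ℂ := x i0 / b with hq
  set p : ℂ := (-(y i0) + a * g * x i0) / a with hp
  have hq0 : q ≠ 0 := div_ne_zero hx0 hb0
  obtain ⟨v, hvx, hvy⟩ : ∃ v : Fin n → ℂ, star x ⬝ᵥ v = p ∧ star y ⬝ᵥ v = q := by
    refine ⟨((p - g * q) / (1 - g * star g)) • x + ((q - star g * p) / (1 - g * star g)) • y,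
      ?_, ?_⟩
    · simp only [dotProduct_add, dotProduct_smul, smul_eq_mul, hx.1, hy.1, hg', ← hg]
      field_simp
      ring
    · simp only [dotProduct_add, dotProduct_smul, smul_eq_mul, hx.1, hy.1, hg', ← hg]
      field_simp
      ring
  set U := pseudoRot θ x * pseudoRot φ y with hUdef
  have hU : Uᴴ * U = 1 := by
    rw [hUdef, Matrix.conjTranspose_mul, mul_assoc, ← mul_assoc _ (pseudoRot θ x),
      P_unit _ _ hx.1, one_mul, P_unit _ _ hy.1]
  have hUv : U *ᵥ v = v + (y i0 • x - x i0 • y) := by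
    rw [hUdef, ← Matrix.mulVec_mulVec, P_mulVec φ, P_mulVec θ, ← ha, ← hb, hvy,
      dotProduct_sub, dotProduct_smul, hvx, ← hg, smul_eq_mul]
    have e1 : b * q = x i0 := by rw [hq]; field_simp
    have e2 : a * (p - b * q * g) = -(y i0) := by rw [e1, hp]; field_simp; ring
    rw [e2, e1]
    module
  have hw0 : y i0 • x - x i0 • y ≠ 0 := by
    intro h
    have := hind (y i0) (-(x i0)) (by rw [← h]; module)
    exact hy0 this.1
  obtain ⟨c, hc0, hc⟩ := exists_unit hw0
  set x' := c • (y i0 • x - x i0 • y) with hx'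
  have hx'U : UV (m - 1) x' := by
    refine ⟨hc, hlast _ ?_ ?_⟩
    · intro i hi
      simp [hx', hx.2 i hi, hy.2 i hi]
    · simp [hx']; right; ring
  obtain ⟨θ', hθ'⟩ := exists_rot (x := x') (z := v) (w := U *ᵥ v) (c := c⁻¹) hc
    (by rw [hUv, hx', smul_smul, inv_mul_cancel₀ hc0, one_smul]) (dot_unit hU v v)
  -- the vector y'
  have hw1 : star p • y - star q • x ≠ 0 := by
    intro h
    have := hind (-(star q)) (star p) (by rw [← h]; module)
    exact hq0 (by simpa using this.1)
  obtain ⟨d, hd0, hdu⟩ := exists_unit hw1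
  set y' := d • (star p • y - star q • x) with hy'
  have hy'U : UV m y' := by
    refine ⟨hdu, ?_⟩
    intro i hi
    simp [hy', hx.2 i hi, hy.2 i hi]
  have hcanc : pseudoRot θ' x' * pseudoRot (-θ') x' = 1 := by
    rw [P_mul_same _ _ _ hc]; simp [P_zero]
  have hcanc' : pseudoRot (-θ') x' * pseudoRot θ' x' = 1 := by
    rw [P_mul_same _ _ _ hc]; simp [P_zero]
  have hmain : pseudoRot (-θ') x' * U = pseudoRot (θ + φ - θ') y' := by
    apply rank_one _ hdu
    · intro z hz
      have hz' : p * (star y ⬝ᵥ z) - q * (star x ⬝ᵥ z) = 0 := by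
        rw [hy'] at hz
        simp only [star_sub, star_smul, sub_dotProduct, smul_dotProduct, star_star,
          smul_eq_mul] at hz
        exact (mul_eq_zero.1 hz).resolve_left (by simpa using hd0)
      set k := (star y ⬝ᵥ z) / q with hk
      set z' := z - k • v with hzz
      have h1 : star y ⬝ᵥ z' = 0 := by
        rw [hzz, dotProduct_sub, dotProduct_smul, hvy, hk, smul_eq_mul]; field_simp; ring
      have h2 : star x ⬝ᵥ z' = 0 := by
        rw [hzz, dotProduct_sub, dotProduct_smul, hvx, hk, smul_eq_mul]; field_simp
        linear_combination -hz'
      have h3 : star x' ⬝ᵥ z' = 0 := by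
        rw [hx']
        simp only [star_sub, star_smul, sub_dotProduct, smul_dotProduct, h1, h2]
        simp
      have h4 : (pseudoRot (-θ') x' * U) *ᵥ z' = z' := by
        rw [hUdef, ← Matrix.mulVec_mulVec, ← Matrix.mulVec_mulVec, P_mulVec φ, h1]
        simp only [mul_zero, zero_smul, sub_zero]
        rw [P_mulVec θ, h2]
        simp only [mul_zero, zero_smul, sub_zero]
        rw [P_mulVec, h3]
        simp only [mul_zero, zero_smul, sub_zero]
      have h5 : (pseudoRot (-θ') x' * U) *ᵥ v = v := by
        rw [← Matrix.mulVec_mulVec, ← hθ', Matrix.mulVec_mulVec, hcanc', Matrix.one_mulVec]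
      have h6 : z = z' + k • v := by rw [hzz]; module
      rw [h6, Matrix.mulVec_add, Matrix.mulVec_smul, h4, h5]
    · rw [Matrix.det_mul, hUdef, Matrix.det_mul, P_det _ _ hc, P_det _ _ hx.1, P_det _ _ hy.1,
        ← Complex.exp_add, ← Complex.exp_add]
      push_cast
      ring_nf
    · rw [Matrix.conjTranspose_mul, mul_assoc, ← mul_assoc _ (pseudoRot (-θ') x') U,
        P_unit _ _ hc, one_mul, hU]
  refine ⟨θ', θ + φ - θ', x', y', hx'U, hy'U, by ring, ?_⟩
  rw [← hmain, ← mul_assoc, hcanc, one_mul]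

theorem stmt18 (n : ℕ) :
    (∀ m₁ m₂ : ℕ, 1 < m₁ → m₁ < m₂ → m₂ ≤ n →
      schubertSet n ![m₂] * schubertSet n ![m₁] = schubertSet n ![m₁, m₂] ∧
      schubertSet n ![m₁] * schubertSet n ![m₂] = schubertSet n ![m₁, m₂]) ∧
    (∀ m' : ℕ, 1 < m' → m' ≤ n →
      schubertSet n ![m'] * schubertSet n ![m'] ⊆ schubertSet n ![m' - 1, m']) := by
  refine ⟨?_, ?_⟩
  · intro m₁ m₂ h1 h2 h3
    refine ⟨?_, mul_eq (by omega) (by omega)⟩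
    rw [mul_eq (by omega) (by omega), swap_eq h2.le]
  · intro m h1 h2
    rw [mul_eq (by omega) (by omega)]
    intro M hM
    obtain ⟨θ, φ, x, y, hx, hy, rfl⟩ := (mem_two M).1 hM
    obtain ⟨θ', φ', x', y', hx', hy', hs, he⟩ := key h1 h2 θ φ hx hy
    exact (mem_two _).2 ⟨θ', φ', x', y', hx', hy', by rw [hs, he]⟩
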